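/- arXiv:nlin/0110030 — 2 statements merged into one kernel-verified Lean document; each statement's English description precedes it below -/
import Mathlib

section
/- Let 0 < γ < 1 and define F: ℝ>0 → ℝ by F(P) = √P for 0 < P ≤ 1 and F(P) = 1 for P ≥ 1. For a > 0, let R: V → ℝ be a solution of the radii system with R(0) = 1 and R(i) = a·tan(γπ/4), and for integers M > N ≥ 0 put P(N,M) = R((N+1)+iM)/R(N+i(M−1)) and Q(N,M) = R(N+iM)/R(N+i(M−1)). Then the following are equivalent: (i) for all integers M > N ≥ 0, P(N,M) > 0 and 0 ≤ Q(N,M) ≤ F(P(N,M)); (ii) a = 1. -/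
open Real

noncomputable section

/-- The cap function `F(P) = √P` for `P ≤ 1` and `F(P) = 1` for `P ≥ 1`. -/
def Fcap (P : ℝ) : ℝ := if P ≤ 1 then Real.sqrt P else 1
/-- Membership of `z = N + i M` in the quadrant `V = {N + iM : M ≥ |N|}`. -/
def inV (N M : ℤ) : Prop := |N| ≤ M

/-- Membership of `z = N + i M` in the interior part `V_int = {N + iM : M > |N|}`. -/
def inVint (N M : ℤ) : Prop := |N| < M

/-- Equation (square) at `z = N + i M`  (here `z + 1` shifts `N`, `z + i` shifts `M`). -/
def SquareEq (γ : ℝ) (R : ℤ → ℤ → ℝ) (N M : ℤ) : Prop :=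
  R N M * R (N + 1) M * (-2 * (M : ℝ) - γ) +
    R (N + 1) M * R (N + 1) (M + 1) * (2 * ((N : ℝ) + 1) - γ) +
    R (N + 1) (M + 1) * R N (M + 1) * (2 * ((M : ℝ) + 1) - γ) +
    R N (M + 1) * R N M * (-2 * (N : ℝ) - γ) = 0

/-- Equation (Ri) at `z = N + i M`. -/
def RiEq (R : ℤ → ℤ → ℝ) (N M : ℤ) : Prop :=
  ((N : ℝ) + M) * (R N M ^ 2 - R (N + 1) M * R N (M - 1)) * (R N (M + 1) + R (N + 1) M) +
    ((M : ℝ) - N) * (R N M ^ 2 - R N (M + 1) * R (N + 1) M) * (R (N + 1) M + R N (M - 1)) = 0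

/-- `R : V → ℝ` is a solution of the radii system: (square) holds whenever all four
corners lie in `V`, (recR) holds on both diagonals, and (Ri) holds on `V_int`. -/
def IsRadiiSolution (γ : ℝ) (R : ℤ → ℤ → ℝ) : Prop :=
  (∀ N M : ℤ, inV N M → inV (N + 1) M → inV N (M + 1) → inV (N + 1) (M + 1) →
      SquareEq γ R N M) ∧
  (∀ N : ℕ, R ((N : ℤ) + 1) ((N : ℤ) + 1) =
        ((2 * (N : ℝ) + γ) / (2 * ((N : ℝ) + 1) - γ)) * R (N : ℤ) (N : ℤ) ∧
      R (-((N : ℤ) + 1)) ((N : ℤ) + 1) =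
        ((2 * (N : ℝ) + γ) / (2 * ((N : ℝ) + 1) - γ)) * R (-(N : ℤ)) (N : ℤ)) ∧
  (∀ N M : ℤ, inVint N M → RiEq R N M)

set_option linter.unusedVariables false
open Filter Topology

/-- mirror relation -/
lemma mirror_of (γ N M e S q r s T : ℝ) (he : 0 < e) (hr : 0 < r) (h1 : N < M) (h2 : 0 < N + M)
    (sq1 : e * (S * (2*N+2-γ) + r * (2*M-γ)) = q * (S * (2*M-2+γ) + r * (2*N+γ)))
    (sq2 : T * (e * (2*N+2-γ) + s * (2*M+2-γ)) = r * (e * (2*M+γ) + s * (2*N+γ)))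
    (ri : (N+M)*(r^2 - e*q)*(s+e) + (M-N)*(r^2-s*e)*(e+q) = 0) :
    e^2 * ((M+N+1)*S + 2*M*r + (M-N-1)*T) = r * ((M-N-1)*r*S + 2*M*T*S + (M+N+1)*r*T) := by
  set D1 := S * (2*M-2+γ) + r * (2*N+γ) with hD1
  set D2 := T * (2*M+2-γ) - r * (2*N+γ) with hD2
  have a1 : D1*(r^2-e*q) = r^2*D1 - e^2*(S * (2*N+2-γ) + r * (2*M-γ)) := by
    linear_combination e*sq1
  have a2 : D1*(e+q) = 2*(N+M)*e*(S+r) := by rw [hD1]; linear_combination -sq1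
  have a3 : D2*(s+e) = 2*(M-N)*e*(r+T) := by rw [hD2]; linear_combination sq2
  have a4 : D2*(r^2-s*e) = r^2*D2 - e^2*(r*(2*M+γ) - T*(2*N+2-γ)) := by
    rw [hD2]; linear_combination (-e)*sq2
  have h : (4*(M-N)*(N+M)*e*r) * (e^2 * ((M+N+1)*S + 2*M*r + (M-N-1)*T) - r * ((M-N-1)*r*S + 2*M*T*S + (M+N+1)*r*T)) = 0 := by
    have e1 : (N+M)*(D1*(r^2 - e*q))*(D2*(s+e)) + (M-N)*(D2*(r^2-s*e))*(D1*(e+q)) = 0 := by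
      linear_combination D1*D2*ri
    rw [a1,a2,a3,a4] at e1
    rw [hD1, hD2] at e1
    linear_combination -e1
  have : 4*(M-N)*(N+M)*e*r ≠ 0 := by
    have := sub_pos.2 h1
    positivity
  have := (mul_eq_zero.1 h).resolve_left this
  linarith

/-- Ri from mirror and linear relation -/
lemma ri_of (m n e S T W E : ℝ) (hS : 0 < S) (hT : 0 < T) (h1 : 0 < m + n) (h2 : 0 < m - n)
    (hm : e^2 * ((m+n)*S + 2*m*W + (m-n)*T) = W * ((m-n)*W*S + 2*m*T*S + (m+n)*W*T))
    (hL : E * ((m+n)*S + (m-n)*T) = W * ((m-n)*S + (m+n)*T)) :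
    (n+m)*(e^2 - E*S)*(T+E) + (m-n)*(e^2-T*E)*(E+S) = 0 := by
  have hh : 0 < (m+n)*S + (m-n)*T := by positivity
  have : ((m+n)*S + (m-n)*T) * ((n+m)*(e^2 - E*S)*(T+E) + (m-n)*(e^2-T*E)*(E+S)) = 0 := by
    set g := (m-n)*S + (m+n)*T with hg
    set h := (m+n)*S + (m-n)*T with hhh
    have t1 : (n+m)*(e^2 - E*S)*(T+E) + (m-n)*(e^2-T*E)*(E+S) = e^2*(g+2*m*E) - E*(2*m*T*S + E*h) := by
      rw [hg, hhh]; ring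
    rw [t1]
    have t2 : e^2*(h + 2*m*W) = W*(2*m*T*S + W*g) := by
      rw [hg, hhh]; linear_combination hm
    linear_combination (2*m*e^2 - 2*m*T*S - E*h - W*g)*hL + g*t2
  exact (mul_eq_zero.1 this).resolve_left hh.ne'

/-- step of linear relation -/
lemma L_step (γ m n e S T Z W W' E E' : ℝ) (h0 : 0 < γ) (hγ : γ < 1) (hn : 1 ≤ n) (hnm : n + 1 ≤ m)
    (he : 0 < e) (hT : 0 < T) (hW : 0 < W) (hW' : 0 < W') (hE : 0 < E)
    (hL : E * ((m+n)*S + (m-n)*T) = W * ((m-n)*S + (m+n)*T))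
    (hm : e^2 * ((m+n)*S + 2*m*W + (m-n)*T) = W * ((m-n)*W*S + 2*m*T*S + (m+n)*W*T))
    (hm' : T^2 * ((m+1+n)*e + 2*(m+1)*W' + (m+1-n)*Z) =
      W' * ((m+1-n)*W'*e + 2*(m+1)*Z*e + (m+1+n)*W'*Z))
    (sqW : T * (e * (2*n-γ) + W' * (2*m+2-γ)) = W * (e * (2*m+γ) + W' * (2*n-2+γ)))
    (sqE : E' * (E * (2*n+2-γ) + T * (2*m+2-γ)) = e * (E * (2*m+γ) + T * (2*n+γ))) :
    E' * ((m+1+n)*e + (m+1-n)*Z) = W' * ((m+1-n)*e + (m+1+n)*Z) := by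
  have K2 : e^2*((m+n)*E-(m-n)*W + 2*n*T) + T^2*((m-n)*E-(m+n)*W) - 2*n*T*W*E = 0 := by
    have : (2*m*W)*(e^2*((m+n)*E-(m-n)*W + 2*n*T) + T^2*((m-n)*E-(m+n)*W) - 2*n*T*W*E) = 0 := by
      have c1 : S*((m+n)*E - (m-n)*W) = T*((m+n)*W - (m-n)*E) := by linear_combination hL
      have c2 : S*(e^2*(m+n) - (m-n)*W^2 - 2*m*T*W) = (m+n)*W^2*T - e^2*(2*m*W+(m-n)*T) := by
        linear_combination hm
      linear_combination (-(e^2*(m+n) - (m-n)*W^2 - 2*m*T*W))*c1 + ((m+n)*E - (m-n)*W)*c2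
    exact (mul_eq_zero.1 this).resolve_left (by
      have : 0 < m := by linarith
      positivity)
  have dW : 0 < e * (2*m+γ) + W' * (2*n-2+γ) := by
    have : 0 < 2*m+γ := by linarith
    have : 0 < 2*n-2+γ := by linarith
    positivity
  have dE : 0 < E * (2*n+2-γ) + T * (2*m+2-γ) := by
    have : 0 < 2*n+2-γ := by linarith
    have : 0 < 2*m+2-γ := by linarith
    positivity
  have K : T^2*((m+1-n)*E'-(m+1+n)*W' - 2*n*e) + e^2*((m+1+n)*E'-(m+1-n)*W') + 2*n*e*W'*E' = 0 := by
    have key : ((m+n)*(E * (2*n+2-γ) + T * (2*m+2-γ))) * (T^2*((m+1-n)*E'-(m+1+n)*W' - 2*n*e) + e^2*((m+1+n)*E'-(m+1-n)*W') + 2*n*e*W'*E') = 0 := by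
      linear_combination (m+n)*(T^2*(m+1-n)+e^2*(m+1+n)+2*n*e*W')*sqE + (m+n+1)*(e * (2*m+γ) + W' * (2*n-2+γ))*K2 + (m+n+1)*(-(m-n)*e^2-(m+n)*T^2-2*n*T*E)*sqW
    have hmn : 0 < m + n := by linarith
    exact (mul_eq_zero.1 key).resolve_left (by positivity)
  have hα : T^2*(m+1-n) - 2*(m+1)*W'*e - (m+1+n)*W'^2 ≠ 0 := by
    intro h
    have h5 : (m+1-n)*W'^2*e - T^2*((m+1+n)*e+2*(m+1)*W') = 0 := by
      linear_combination Z*h - hm'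
    have h6 : (m+1-n)^2*W'^2*e = W'*(2*(m+1)*e+(m+1+n)*W')*((m+1+n)*e+2*(m+1)*W') := by
      linear_combination (m+1-n)*h5 + ((m+1+n)*e+2*(m+1)*W')*h
    have p1 : 0 < m+1-n := by linarith
    have p2 : 0 < m+1+n := by linarith
    have p3 : 0 < m+1 := by linarith
    have h7 : W'*(2*(m+1)*e+(m+1+n)*W')*((m+1+n)*e+2*(m+1)*W') - (m+1-n)^2*W'^2*e
      = W'*(2*(m+1)*(m+1+n)*e^2 + (4*(m+1)^2 + 4*(m+1)*n)*e*W' + 2*(m+1)*(m+1+n)*W'^2) := by ring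
    have h8 : 0 < W'*(2*(m+1)*(m+1+n)*e^2 + (4*(m+1)^2 + 4*(m+1)*n)*e*W' + 2*(m+1)*(m+1+n)*W'^2) := by
      have : 0 < n := by linarith
      positivity
    linarith
  have : (T^2*(m+1-n) - 2*(m+1)*W'*e - (m+1+n)*W'^2) * (E' * ((m+1+n)*e + (m+1-n)*Z) - W' * ((m+1-n)*e + (m+1+n)*Z)) = 0 := by
    linear_combination ((m+1-n)*E' - (m+1+n)*W')*hm' - 2*(m+1)*W'*K
  have := (mul_eq_zero.1 this).resolve_left hα
  linarith

/-- product relation on the first layer -/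
lemma layer1 (γ N q r s p p' : ℝ) (h0 : 0 < γ) (hγ : γ < 1) (hN : 0 ≤ N) (hq : 0 < q) (hr : r ≠ 0)
    (hp : p = (2*N+γ)/(2*(N+1)-γ) * q)
    (ri : (N+(N+1))*(r^2 - p*q)*(s+p) + ((N+1)-N)*(r^2-s*p)*(p+q) = 0)
    (sq : p' * (p * (2*N+2-γ) + s * (2*N+4-γ)) = r * (p * (2*N+2+γ) + s * (2*N+γ))) :
    r * p' = p^2 := by
  have hA : 0 < 2*(N+1)-γ := by linarith
  have hp' : p * (2*N+2-γ) = (2*N+γ)*q := by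
    rw [hp]; field_simp
  have h2N : 0 < 2*N+1 := by linarith
  have r1 : (r^2-p*q)*(s+p)*(2*N+2-γ) + 2*q*(r^2-s*p) = 0 := by
    have : (2*N+1) * ((r^2-p*q)*(s+p)*(2*N+2-γ) + 2*q*(r^2-s*p)) = 0 := by
      linear_combination (2*N+2-γ)*ri - (r^2-s*p)*hp'
    exact (mul_eq_zero.1 this).resolve_left h2N.ne'
  set D := (2*N+2-γ)*r^2 - p*q*(2*N+4-γ) with hD
  have r2 : s * D = q*((2*N+γ)*q*p - r^2*(2*N+2+γ)) := by
    rw [hD]; linear_combination r1 - (r^2-p*q)*hp'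
  have r3 : p' * (p * (2*N+2-γ) * D + (s*D) * (2*N+4-γ)) = r * (p * (2*N+2+γ) * D + (s*D) * (2*N+γ)) := by
    linear_combination D*sq
  rw [r2, hD, hp'] at r3
  have r4 : (q*(-(8*N+8))*r) * (r*p' - p^2) = 0 := by
    linear_combination r3 + r*(r^2*(2*N+2+γ) - p*q*(2*N+γ))*hp'
  have := (mul_eq_zero.1 r4).resolve_left (by
    have : (8*N+8) ≠ 0 := by linarith
    simp [hr, hq.ne']
    intro h; apply this; linarith)
  linarith

lemma L_base (γ n e S T W q : ℝ) (h0 : 0 < γ) (hγ : γ < 1) (hn : 1 ≤ n) (hS : 0 < S) (hT : 0 < T) (hW : 0 < W)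
    (he : 0 < e) (hqe : q * e = S^2)
    (sq : e * (S * (2*n-γ) + W * (2*n+2-γ)) = q * (S * (2*n+γ) + W * (2*n-2+γ)))
    (hm : e^2 * ((2*n+1)*S + 2*(n+1)*W + T) = W * (W*S + 2*(n+1)*T*S + (2*n+1)*W*T)) :
    S*(2*n+γ)*((2*n+1)*S + T) = (2*n+2-γ)*(W * (S + (2*n+1)*T)) := by
  have h1 : e^2 * (S * (2*n-γ) + W * (2*n+2-γ)) = S^2 * (S * (2*n+γ) + W * (2*n-2+γ)) := by
    linear_combination e*sq + (S * (2*n+γ) + W * (2*n-2+γ))*hqe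
  have h2 : (S+W)^2 * (S*(2*n+γ)*((2*n+1)*S + T) - (2*n+2-γ)*(W * (S + (2*n+1)*T))) = 0 := by
    linear_combination (S * (2*n-γ) + W * (2*n+2-γ))*hm - ((2*n+1)*S + 2*(n+1)*W + T)*h1
  have := (mul_eq_zero.1 h2).resolve_left (by positivity)
  linarith

/-- positivity on the second layer gives a lower bound on the first layer ratio -/
lemma thresh (γ N q r s p : ℝ) (h0 : 0 < γ) (hγ : γ < 1) (hN : 0 ≤ N) (hq : 0 < q) (hr : 0 < r) (hs : 0 < s)
    (hp : p = (2*N+γ)/(2*(N+1)-γ) * q)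
    (ri : (N+(N+1))*(r^2 - p*q)*(s+p) + ((N+1)-N)*(r^2-s*p)*(p+q) = 0) :
    (2*N+γ)^2 * q^2 < r^2 * ((2*N+2-γ)*(2*N+2+γ)) := by
  have hA : 0 < 2*(N+1)-γ := by linarith
  have hB : 0 < 2*N+γ := by linarith
  have hA2 : 0 < 2*N+2-γ := by linarith
  have hB2 : 0 < 2*N+2+γ := by linarith
  have hp' : p * (2*N+2-γ) = (2*N+γ)*q := by
    rw [hp]; field_simp
  have hp0 : 0 < p := by rw [hp]; positivity
  have h2N : 0 < 2*N+1 := by linarith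
  have r1 : (r^2-p*q)*(s+p)*(2*N+2-γ) + 2*q*(r^2-s*p) = 0 := by
    have : (2*N+1) * ((r^2-p*q)*(s+p)*(2*N+2-γ) + 2*q*(r^2-s*p)) = 0 := by
      linear_combination (2*N+2-γ)*ri - (r^2-s*p)*hp'
    exact (mul_eq_zero.1 this).resolve_left h2N.ne'
  have r2 : s * ((2*N+2-γ)*r^2 - p*q*(2*N+4-γ)) = q*((2*N+γ)*q*p - r^2*(2*N+2+γ)) := by
    linear_combination r1 - (r^2-p*q)*hp'
  by_contra hc
  push Not at hc
  have h3 : r^2*(2*N+2+γ) ≤ (2*N+γ)*q*p := by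
    have : (r^2*(2*N+2+γ)) * (2*N+2-γ) ≤ ((2*N+γ)*q*p)*(2*N+2-γ) := by
      have : ((2*N+γ)*q*p)*(2*N+2-γ) = (2*N+γ)^2 * q^2 := by linear_combination (2*N+γ)*q*hp'
      rw [this]; linarith
    exact le_of_mul_le_mul_right this hA2
  have h4 : 0 ≤ (2*N+2-γ)*r^2 - p*q*(2*N+4-γ) := by
    by_contra h; push Not at h
    have h5 : s * ((2*N+2-γ)*r^2 - p*q*(2*N+4-γ)) < 0 := mul_neg_of_pos_of_neg hs h
    rw [r2] at h5
    have : 0 ≤ q*((2*N+γ)*q*p - r^2*(2*N+2+γ)) := mul_nonneg hq.le (by linarith)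
    linarith
  have h6 : p*q*((2*N+4-γ)*(2*N+2+γ)) ≤ p*q*((2*N+2-γ)*(2*N+γ)) := by
    nlinarith [mul_le_mul_of_nonneg_left h3 hA2.le, mul_le_mul_of_nonneg_left h4 hB2.le]
  have := le_of_mul_le_mul_left h6 (by positivity)
  nlinarith

/-- positive column data -/
structure Col (γ : ℝ) (N : ℕ) (f g : ℕ → ℝ) : Prop where
  fpos : ∀ j, 0 < f j
  gpos : ∀ j, 0 < g j
  g0 : g 0 = (2*(N:ℝ)+γ)/(2*((N:ℝ)+1)-γ) * f 0
  ri : ∀ j : ℕ, (2*(N:ℝ)+j+1)*(f (j+1)^2 - g j * f j)*(f (j+2)+g j)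
    + ((j:ℝ)+1)*(f (j+1)^2 - f (j+2)*g j)*(g j + f j) = 0
  sq : ∀ j : ℕ, g (j+1)*(g j*(2*(N:ℝ)+2-γ) + f (j+2)*(2*((N:ℝ)+j+1)+2-γ))
    = f (j+1)*(g j*(2*((N:ℝ)+j+1)+γ)+f (j+2)*(2*(N:ℝ)+γ))

/-- the next column -/
def nextW (γ : ℝ) (N : ℕ) (g : ℕ → ℝ) : ℕ → ℝ
  | 0 => (2*(N+1:ℝ)+γ)/(2*((N+1:ℝ)+1)-γ) * g 0
  | j+1 => g (j+1)*(nextW γ N g j*(2*((N:ℝ)+j+2)+γ)+g (j+2)*(2*(N:ℝ)+2+γ)) /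
     (nextW γ N g j*(2*(N:ℝ)+4-γ) + g (j+2)*(2*((N:ℝ)+j+2)+2-γ))

lemma Col.prod {γ : ℝ} (h0 : 0 < γ) (hγ : γ < 1) {N : ℕ} {f g : ℕ → ℝ} (h : Col γ N f g) :
    f 1 * g 1 = (g 0)^2 := by
  have h1 := h.ri 0
  have h2 := h.sq 0
  simp only [Nat.cast_zero, zero_add] at h1 h2
  refine layer1 γ N (f 0) (f 1) (f 2) (g 0) (g 1) h0 hγ (Nat.cast_nonneg N) (h.fpos 0) (h.fpos 1).ne' h.g0 ?_ ?_
  · linear_combination h1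
  · linear_combination h2

lemma Col.next {γ : ℝ} (h0 : 0 < γ) (hγ : γ < 1) {N : ℕ} {f g : ℕ → ℝ} (h : Col γ N f g) :
    Col γ (N+1) g (nextW γ N g) := by
  have hN : (0:ℝ) ≤ N := Nat.cast_nonneg N
  have wpos : ∀ j, 0 < nextW γ N g j := by
    intro j
    induction j with
    | zero =>
      have := h.gpos 0
      have : 0 < 2*((N+1:ℝ)+1)-γ := by linarith
      simp only [nextW]; positivity
    | succ j ih =>
      have := h.gpos (j+1)
      have := h.gpos (j+2)
      have hj : (0:ℝ) ≤ j := Nat.cast_nonneg j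
      have : 0 < 2*(N:ℝ)+4-γ := by linarith
      have : 0 < 2*((N:ℝ)+j+2)+2-γ := by linarith
      simp only [nextW]; positivity
  have wsq : ∀ j : ℕ, nextW γ N g (j+1) * (nextW γ N g j*(2*(N:ℝ)+4-γ) + g (j+2)*(2*((N:ℝ)+j+2)+2-γ))
      = g (j+1)*(nextW γ N g j*(2*((N:ℝ)+j+2)+γ)+g (j+2)*(2*(N:ℝ)+2+γ)) := by
    intro j
    have := wpos j
    have := h.gpos (j+2)
    have hj : (0:ℝ) ≤ j := Nat.cast_nonneg j
    have : 0 < 2*(N:ℝ)+4-γ := by linarith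
    have : 0 < 2*((N:ℝ)+j+2)+2-γ := by linarith
    have hd : 0 < nextW γ N g j*(2*(N:ℝ)+4-γ) + g (j+2)*(2*((N:ℝ)+j+2)+2-γ) := by positivity
    rw [nextW, div_mul_cancel₀ _ hd.ne']
  have mir : ∀ j : ℕ, g (j+1)^2 * (((N:ℝ)+j+2+N+1)*g j + 2*((N:ℝ)+j+2)*f (j+2) + ((N:ℝ)+j+2-N-1)*g (j+2))
      = f (j+2) * (((N:ℝ)+j+2-N-1)*f (j+2)*g j + 2*((N:ℝ)+j+2)*g (j+2)*g j + ((N:ℝ)+j+2+N+1)*f (j+2)*g (j+2)) := by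
    intro j
    have hj : (0:ℝ) ≤ j := Nat.cast_nonneg j
    have s1 := h.sq j
    have s2 := h.sq (j+1)
    have s3 := h.ri (j+1)
    push_cast at s2 s3
    refine mirror_of γ N (N+j+2) (g (j+1)) (g j) (f (j+1)) (f (j+2)) (f (j+3)) (g (j+2)) (h.gpos _) (h.fpos _)
      (by linarith) (by linarith) ?_ ?_ ?_
    · linear_combination s1
    · linear_combination s2
    · linear_combination s3
  have hL : ∀ j : ℕ, nextW γ N g j * ((((N:ℝ)+j+2)+(N+1))*g j + (((N:ℝ)+j+2)-(N+1))*g (j+2))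
      = f (j+2) * ((((N:ℝ)+j+2)-(N+1))*g j + (((N:ℝ)+j+2)+(N+1))*g (j+2)) := by
    intro j
    induction j with
    | zero =>
      have s1 := h.sq 0
      have m0 := mir 0
      simp only [Nat.cast_zero, zero_add] at s1 m0
      have hb := L_base γ (N+1) (g 1) (g 0) (g 2) (f 2) (f 1) h0 hγ (by linarith) (h.gpos _) (h.gpos _) (h.fpos _)
        (h.gpos _) (h.prod h0 hγ) (by linear_combination s1) (by linear_combination m0)
      have hA : 0 < 2*((N+1:ℝ)+1)-γ := by linarith
      have hw : nextW γ N g 0 * (2*((N+1:ℝ)+1)-γ) = (2*(N+1:ℝ)+γ) * g 0 := by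
        simp only [nextW]; field_simp
      apply mul_left_cancel₀ hA.ne'
      simp only [Nat.cast_zero, zero_add]
      linear_combination hb + ((((N:ℝ)+0+2)+(N+1))*g 0 + (((N:ℝ)+0+2)-(N+1))*g 2)*hw
    | succ j ih =>
      have hj : (0:ℝ) ≤ j := Nat.cast_nonneg j
      have m1 := mir j
      have m2 := mir (j+1)
      have s2 := h.sq (j+1)
      have s3 := wsq j
      push_cast at m2 s2 ⊢
      have := L_step γ (N+j+2) (N+1) (g (j+1)) (g j) (g (j+2)) (g (j+3)) (f (j+2)) (f (j+3)) (nextW γ N g j)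
        (nextW γ N g (j+1)) h0 hγ (by linarith) (by linarith) (h.gpos _) (h.gpos _) (h.fpos _) (h.fpos _) (wpos _)
        ih (by linear_combination m1) (by linear_combination m2) (by linear_combination s2) (by linear_combination s3)
      linear_combination this
  refine ⟨h.gpos, wpos, ?_, ?_, ?_⟩
  · simp only [nextW]; push_cast; ring
  · intro j
    have hj : (0:ℝ) ≤ j := Nat.cast_nonneg j
    have := ri_of (N+j+2) (N+1) (g (j+1)) (g j) (g (j+2)) (f (j+2)) (nextW γ N g j) (h.gpos _) (h.gpos _)
      (by linarith) (by linarith) (by linear_combination mir j) (hL j)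
    push_cast
    linear_combination this
  · intro j
    push_cast
    linear_combination wsq j

lemma Col.thresh {γ : ℝ} (h0 : 0 < γ) (hγ : γ < 1) {N : ℕ} {f g : ℕ → ℝ} (h : Col γ N f g) :
    (2*(N:ℝ)+γ)^2 * f 0^2 < f 1^2 * ((2*(N:ℝ)+2-γ)*(2*(N:ℝ)+2+γ)) := by
  have h1 := h.ri 0
  simp only [Nat.cast_zero, zero_add] at h1
  refine _root_.thresh γ N (f 0) (f 1) (f 2) (g 0) h0 hγ (Nat.cast_nonneg N) (h.fpos 0) (h.fpos 1) (h.fpos 2) h.g0 ?_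
  linear_combination h1


/-- diagonal coefficient -/
def cc (γ : ℝ) (n : ℕ) : ℝ := (2*(n:ℝ)+γ)/(2*((n:ℝ)+1)-γ)

lemma cc_pos {γ : ℝ} (h0 : 0 < γ) (hγ : γ < 1) (n : ℕ) : 0 < cc γ n := by
  have hN : (0:ℝ) ≤ n := Nat.cast_nonneg n
  have : 0 < 2*((n:ℝ)+1)-γ := by linarith
  unfold cc; positivity

lemma Col.ratio {γ : ℝ} (h0 : 0 < γ) (hγ : γ < 1) {N : ℕ} {f g : ℕ → ℝ} (h : Col γ N f g) :
    (f 1 / f 0) * (g 1 / g 0) = cc γ N := by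
  have h1 := h.prod h0 hγ
  have h2 : g 0 = cc γ N * f 0 := h.g0
  have := (h.gpos 0).ne'
  have := (h.fpos 0).ne'
  rw [div_mul_div_comm, h1, div_eq_iff (by positivity), pow_two]
  nth_rewrite 1 [h2]
  ring

lemma Col.chain {γ : ℝ} (h0 : 0 < γ) (hγ : γ < 1) {N : ℕ} {f g : ℕ → ℝ} (h : Col γ N f g)
    (ρ : ℕ → ℝ) (hρ : ∀ n, 0 < ρ n) (hrec : ∀ n, ρ n * ρ (n+1) = cc γ n) (i : ℕ) :
    ∃ f' g', Col γ (N+2*i) f' g' ∧ f' 1 / f' 0 / ρ (N+2*i) = f 1 / f 0 / ρ N := by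
  induction i with
  | zero => exact ⟨f, g, h, rfl⟩
  | succ i ih =>
    obtain ⟨f', g', hc, he⟩ := ih
    have c1 := hc.next h0 hγ
    have c2 := c1.next h0 hγ
    refine ⟨_, _, c2, ?_⟩
    rw [← he]
    have e1 := hc.ratio h0 hγ
    have e2 := c1.ratio h0 hγ
    have r1 := hrec (N+2*i)
    have r2 := hrec (N+2*i+1)
    set w := nextW γ (N+2*i) g' with hw
    change w 1 / w 0 / ρ (N+2*i+1+1) = _
    have p1 : 0 < f' 1 / f' 0 := div_pos (hc.fpos _) (hc.fpos _)
    have p2 : 0 < g' 1 / g' 0 := div_pos (hc.gpos _) (hc.gpos _)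
    rw [div_eq_div_iff (hρ _).ne' (hρ _).ne']
    have p3 := hρ (N+2*i+1)
    apply mul_left_cancel₀ (mul_pos p2 p3).ne'
    rw [← r1] at e1
    rw [← r2] at e2
    linear_combination (ρ (N+2*i+1) * ρ (N+2*i))*e2 - (ρ (N+2*i+1) * ρ (N+2*i+1+1))*e1

lemma Col.ge {γ : ℝ} (h0 : 0 < γ) (hγ : γ < 1) {N : ℕ} {f g : ℕ → ℝ} (h : Col γ N f g)
    (ρ : ℕ → ℝ) (hρ : ∀ n, 0 < ρ n) (hrec : ∀ n, ρ n * ρ (n+1) = cc γ n)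
    (hlim : Tendsto ρ atTop (𝓝 1)) : ρ N ≤ f 1 / f 0 := by
  set κ := f 1 / f 0 / ρ N with hκ
  have κpos : 0 < κ := div_pos (div_pos (h.fpos _) (h.fpos _)) (hρ _)
  have hb : ∀ i : ℕ, (2*((N+2*i:ℕ):ℝ)+γ)^2/((2*((N+2*i:ℕ):ℝ)+2-γ)*(2*((N+2*i:ℕ):ℝ)+2+γ)) ≤ (κ * ρ (N+2*i))^2 := by
    intro i
    obtain ⟨f', g', hc, he⟩ := h.chain h0 hγ ρ hρ hrec i
    have := hc.thresh h0 hγ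
    have hN : (0:ℝ) ≤ (N+2*i:ℕ) := Nat.cast_nonneg _
    have q1 : 0 < 2*((N+2*i:ℕ):ℝ)+2-γ := by linarith
    have q2 : 0 < 2*((N+2*i:ℕ):ℝ)+2+γ := by linarith
    rw [← hκ] at he
    have e : κ * ρ (N+2*i) = f' 1 / f' 0 := by
      rw [← he, div_mul_cancel₀ _ (hρ _).ne']
    rw [e, div_pow, div_le_div_iff₀ (by positivity) (pow_pos (hc.fpos 0) 2)]
    exact this.le
  have hsub : Tendsto (fun i : ℕ => N+2*i) atTop atTop :=
    tendsto_atTop_mono (fun i => by simp only [id]; omega) tendsto_id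
  have l1 : Tendsto (fun i : ℕ => (κ * ρ (N+2*i))^2) atTop (𝓝 ((κ*1)^2)) :=
    ((hlim.comp hsub).const_mul κ).pow 2
  have l2 : Tendsto (fun n : ℕ => (2*(n:ℝ)+γ)^2/((2*(n:ℝ)+2-γ)*(2*(n:ℝ)+2+γ))) atTop (𝓝 1) := by
    have inv : Tendsto (fun n : ℕ => (n:ℝ)⁻¹) atTop (𝓝 0) := tendsto_inv_atTop_nhds_zero_nat
    have : Tendsto (fun n : ℕ => (2+γ*(n:ℝ)⁻¹)^2/((2+(2-γ)*(n:ℝ)⁻¹)*(2+(2+γ)*(n:ℝ)⁻¹))) atTop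
        (𝓝 ((2+γ*0)^2/((2+(2-γ)*0)*(2+(2+γ)*0)))) := by
      refine Tendsto.div ((tendsto_const_nhds.add (inv.const_mul _)).pow 2)
        ((tendsto_const_nhds.add (inv.const_mul _)).mul (tendsto_const_nhds.add (inv.const_mul _))) (by norm_num)
    have e : (2+γ*0)^2/((2+(2-γ)*0)*(2+(2+γ)*0)) = (1:ℝ) := by norm_num
    rw [e] at this
    refine this.congr' ?_
    filter_upwards [eventually_gt_atTop 0] with n hn
    have hn' : (0:ℝ) < n := by exact_mod_cast hn
    have q1 : 0 < 2*(n:ℝ)+2-γ := by linarith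
    have q2 : 0 < 2*(n:ℝ)+2+γ := by linarith
    have a1 : 2+γ*(n:ℝ)⁻¹ = (2*n+γ)/n := by field_simp
    have a2 : 2+(2-γ)*(n:ℝ)⁻¹ = (2*n+2-γ)/n := by field_simp; ring
    have a3 : 2+(2+γ)*(n:ℝ)⁻¹ = (2*n+2+γ)/n := by field_simp; ring
    rw [a1, a2, a3]
    field_simp
  have := le_of_tendsto_of_tendsto' (l2.comp hsub) l1 hb
  have k1 : 1 ≤ κ := by nlinarith
  have := hρ N
  rw [hκ, le_div_iff₀ this] at k1
  linarith

lemma Col.eq {γ : ℝ} (h0 : 0 < γ) (hγ : γ < 1) {N : ℕ} {f g : ℕ → ℝ} (h : Col γ N f g)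
    (ρ : ℕ → ℝ) (hρ : ∀ n, 0 < ρ n) (hrec : ∀ n, ρ n * ρ (n+1) = cc γ n)
    (hlim : Tendsto ρ atTop (𝓝 1)) : f 1 / f 0 = ρ N := by
  have a1 := h.ge h0 hγ ρ hρ hrec hlim
  have a2 := (h.next h0 hγ).ge h0 hγ ρ hρ hrec hlim
  have e := h.ratio h0 hγ
  rw [← hrec N] at e
  have := hρ N
  have := hρ (N+1)
  apply le_antisymm _ a1
  by_contra hc
  push Not at hc
  have := mul_lt_mul hc a2 (hρ (N+1)) (div_pos (h.fpos 1) (h.fpos 0)).le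
  linarith

lemma rho_even {γ : ℝ} (h0 : 0 < γ) (hγ : γ < 1) (ρ : ℕ → ℝ) (hρ : ∀ n, 0 < ρ n)
    (hrec : ∀ n, ρ n * ρ (n+1) = cc γ n) (k : ℕ) :
    ρ (2*k) = ρ 0 * ∏ j ∈ Finset.range k, (cc γ (2*j+1) / cc γ (2*j)) := by
  induction k with
  | zero => simp
  | succ k ih =>
    rw [Finset.prod_range_succ, ← mul_assoc, ← ih, ← hrec, ← hrec]
    have := (hρ (2*k)).ne'
    have := (hρ (2*k+1)).ne'
    rw [show 2*(k+1) = 2*k+1+1 by ring]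
    field_simp

lemma gamma_prod {γ : ℝ} (h0 : 0 < γ) (hγ : γ < 1) :
    Tendsto (fun k : ℕ => ∏ j ∈ Finset.range (k+1), (cc γ (2*j+1) / cc γ (2*j))) atTop
      (𝓝 (Real.tan (γ * Real.pi / 4))⁻¹) := by
  set x := γ/4 with hx
  have hlim := ((Real.GammaSeq_tendsto_Gamma x).mul (Real.GammaSeq_tendsto_Gamma (1-x))).div
    ((Real.GammaSeq_tendsto_Gamma (1/2+x)).mul (Real.GammaSeq_tendsto_Gamma (1-(1/2+x)))) (by
      rw [Real.Gamma_mul_Gamma_one_sub]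
      have : 0 < Real.sin (Real.pi*(1/2+x)) := Real.sin_pos_of_pos_of_lt_pi (by positivity) (by
        have := Real.pi_pos
        nlinarith)
      have := Real.pi_pos
      positivity)
  rw [Real.Gamma_mul_Gamma_one_sub, Real.Gamma_mul_Gamma_one_sub] at hlim
  have hv : Real.pi / Real.sin (Real.pi * x) / (Real.pi / Real.sin (Real.pi * (1/2+x))) = (Real.tan (γ * Real.pi / 4))⁻¹ := by
    have a1 : Real.sin (Real.pi * (1/2+x)) = Real.cos (γ*Real.pi/4) := by
      rw [← Real.sin_add_pi_div_two]; congr 1; rw [hx]; ring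
    have a2 : Real.pi * x = γ*Real.pi/4 := by rw [hx]; ring
    rw [a1, a2, Real.tan_eq_sin_div_cos, inv_div]
    have := Real.pi_pos.ne'
    by_cases hs : Real.sin (γ*Real.pi/4) = 0
    · simp [hs]
    · field_simp
  rw [hv] at hlim
  refine hlim.congr' ?_
  filter_upwards [eventually_gt_atTop 0] with n hn
  have hn' : (0:ℝ) < n := by exact_mod_cast hn
  simp only [Pi.mul_apply, Pi.div_apply, Real.GammaSeq]
  have pw : ∀ y : ℝ, (n:ℝ)^y * (n:ℝ)^(1-y) = n := by
    intro y; rw [← Real.rpow_add hn']; simp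
  have hf : (0:ℝ) < (n.factorial : ℝ) := by exact_mod_cast n.factorial_pos
  have pp : ∀ y : ℝ, 0 < y → 0 < ∏ j ∈ Finset.range (n+1), (y + (j:ℝ)) := by
    intro y hy; exact Finset.prod_pos (fun j _ => by positivity)
  have q1 := pp x (by positivity)
  have q2 := pp (1-x) (by linarith)
  have q3 := pp (1/2+x) (by positivity)
  have q4 := pp (1-(1/2+x)) (by linarith)
  have comb : ∀ y : ℝ, (n:ℝ)^y * (n.factorial:ℝ) / (∏ j ∈ Finset.range (n+1), (y + (j:ℝ))) *
     ((n:ℝ)^(1-y) * (n.factorial:ℝ) / (∏ j ∈ Finset.range (n+1), ((1-y) + (j:ℝ)))) =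
     (n * (n.factorial:ℝ)^2) / ((∏ j ∈ Finset.range (n+1), (y + (j:ℝ))) * (∏ j ∈ Finset.range (n+1), ((1-y) + (j:ℝ)))) := by
    intro y
    rw [div_mul_div_comm]
    congr 1
    linear_combination (n.factorial:ℝ)^2 * pw y
  rw [comb, comb]
  have : (n * (n.factorial:ℝ)^2) ≠ 0 := by positivity
  rw [div_div_div_cancel_left' _ _ this]
  rw [← Finset.prod_mul_distrib, ← Finset.prod_mul_distrib, ← Finset.prod_div_distrib]
  refine Finset.prod_congr rfl (fun j _ => ?_)
  have hj : (0:ℝ) ≤ j := Nat.cast_nonneg j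
  simp only [cc]
  push_cast
  have b1 : 2*(2*(j:ℝ)+1+1)-γ ≠ 0 := by linarith
  have b2 : 2*(2*(j:ℝ)+1)-γ ≠ 0 := by linarith
  have b3 : 2*(2*(j:ℝ))+γ ≠ 0 := by positivity
  have b4 : x + j ≠ 0 := by positivity
  have b5 : 1 - x + j ≠ 0 := by linarith
  rw [div_div_div_eq, div_eq_div_iff (by positivity) (by positivity), hx]
  ring


lemma cc_lim {γ : ℝ} (h0 : 0 < γ) (hγ : γ < 1) : Tendsto (cc γ) atTop (𝓝 1) := by
  have inv : Tendsto (fun n : ℕ => (n:ℝ)⁻¹) atTop (𝓝 0) := tendsto_inv_atTop_nhds_zero_nat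
  have : Tendsto (fun n : ℕ => (2+γ*(n:ℝ)⁻¹)/(2+(2-γ)*(n:ℝ)⁻¹)) atTop
      (𝓝 ((2+γ*0)/(2+(2-γ)*0))) :=
    Tendsto.div (tendsto_const_nhds.add (inv.const_mul _))
      (tendsto_const_nhds.add (inv.const_mul _)) (by norm_num)
  have e : (2+γ*0)/(2+(2-γ)*0) = (1:ℝ) := by norm_num
  rw [e] at this
  refine this.congr' ?_
  filter_upwards [eventually_gt_atTop 0] with n hn
  have hn' : (0:ℝ) < n := by exact_mod_cast hn
  have q1 : 0 < 2*((n:ℝ)+1)-γ := by linarith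
  have a1 : 2+γ*(n:ℝ)⁻¹ = (2*n+γ)/n := by field_simp
  have a2 : 2+(2-γ)*(n:ℝ)⁻¹ = (2*(n+1)-γ)/n := by field_simp; ring
  rw [a1, a2, cc]
  field_simp

lemma rho_lim_even {γ : ℝ} (h0 : 0 < γ) (hγ : γ < 1) (a : ℝ) (ρ : ℕ → ℝ) (hρ : ∀ n, 0 < ρ n)
    (hrec : ∀ n, ρ n * ρ (n+1) = cc γ n) (hst : ρ 0 = a * Real.tan (γ * Real.pi / 4)) :
    Tendsto (fun k => ρ (2*k)) atTop (𝓝 a) := by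
  rw [← tendsto_add_atTop_iff_nat 1]
  have := (gamma_prod h0 hγ).const_mul (ρ 0)
  have ht : Real.tan (γ * Real.pi / 4) ≠ 0 := by
    intro h
    have := hρ 0
    rw [hst, h] at this
    simp at this
  have e : ρ 0 * (Real.tan (γ * Real.pi / 4))⁻¹ = a := by
    rw [hst]; field_simp
  rw [e] at this
  refine this.congr (fun k => ?_)
  rw [rho_even h0 hγ ρ hρ hrec]

lemma rho_lim_odd {γ : ℝ} (h0 : 0 < γ) (hγ : γ < 1) (a : ℝ) (ha : 0 < a) (ρ : ℕ → ℝ) (hρ : ∀ n, 0 < ρ n)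
    (hrec : ∀ n, ρ n * ρ (n+1) = cc γ n) (hst : ρ 0 = a * Real.tan (γ * Real.pi / 4)) :
    Tendsto (fun k => ρ (2*k+1)) atTop (𝓝 (1/a)) := by
  have h2 : Tendsto (fun k : ℕ => 2*k) atTop atTop :=
    tendsto_atTop_mono (fun i => by simp only [id]; omega) tendsto_id
  have := ((cc_lim h0 hγ).comp h2).div (rho_lim_even h0 hγ a ρ hρ hrec hst) ha.ne'
  refine this.congr (fun k => ?_)
  simp only [Pi.div_apply, Function.comp]
  rw [div_eq_iff (hρ _).ne', ← hrec]; ring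

lemma rho_lim {γ : ℝ} (h0 : 0 < γ) (hγ : γ < 1) (ρ : ℕ → ℝ) (hρ : ∀ n, 0 < ρ n)
    (hrec : ∀ n, ρ n * ρ (n+1) = cc γ n) (hst : ρ 0 = 1 * Real.tan (γ * Real.pi / 4)) :
    Tendsto ρ atTop (𝓝 1) := by
  have e := rho_lim_even h0 hγ 1 ρ hρ hrec hst
  have o := rho_lim_odd h0 hγ 1 one_pos ρ hρ hrec hst
  rw [div_one] at o
  rw [Metric.tendsto_atTop] at *
  intro ε hε
  obtain ⟨A, hA⟩ := e ε hε
  obtain ⟨B, hB⟩ := o ε hε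
  refine ⟨2*A+2*B+1, fun n hn => ?_⟩
  obtain ⟨k, hk | hk⟩ := Nat.even_or_odd' n
  · rw [hk]; exact hA k (by omega)
  · rw [hk]; exact hB k (by omega)

lemma rho_eq_one {γ : ℝ} (h0 : 0 < γ) (hγ : γ < 1) (a : ℝ) (ha : 0 < a) (ρ : ℕ → ℝ) (hρ : ∀ n, 0 < ρ n)
    (hrec : ∀ n, ρ n * ρ (n+1) = cc γ n) (hst : ρ 0 = a * Real.tan (γ * Real.pi / 4))
    (hle : ∀ n, ρ n ≤ 1) : a = 1 := by
  have e := le_of_tendsto' (rho_lim_even h0 hγ a ρ hρ hrec hst) (fun k => hle _)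
  have o := le_of_tendsto' (rho_lim_odd h0 hγ a ha ρ hρ hrec hst) (fun k => hle _)
  rw [div_le_one ha] at o
  linarith


lemma last_zero {F : ℝ → ℝ} {a b : ℝ} (hab : a < b) (hF : ContinuousOn F (Set.Icc a b))
    (ha : F a < 0) (hb : 0 < F b) :
    ∃ c, a < c ∧ c < b ∧ F c = 0 ∧ ∀ t ∈ Set.Ioc c b, 0 < F t := by
  have hcl : IsClosed (Set.Icc a b ∩ F ⁻¹' Set.Iic 0) :=
    hF.preimage_isClosed_of_isClosed isClosed_Icc isClosed_Iic
  have hco : IsCompact (Set.Icc a b ∩ F ⁻¹' Set.Iic 0) :=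
    isCompact_Icc.of_isClosed_subset hcl Set.inter_subset_left
  obtain ⟨c, ⟨hc1, hc2⟩, hc3⟩ := hco.exists_isGreatest ⟨a, ⟨le_rfl, hab.le⟩, ha.le⟩
  have hc2' : F c ≤ 0 := hc2
  have hcb : c < b := lt_of_le_of_ne hc1.2 (by rintro rfl; linarith)
  have hz : F c = 0 := by
    obtain ⟨d, hd, hd0⟩ := intermediate_value_Icc hcb.le
      (hF.mono (Set.Icc_subset_Icc_left hc1.1)) (show (0:ℝ) ∈ Set.Icc (F c) (F b) from ⟨hc2', hb.le⟩)
    have : d ≤ c := hc3 ⟨⟨hc1.1.trans hd.1, hd.2⟩, hd0.le⟩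
    rw [← le_antisymm this hd.1]; exact hd0
  refine ⟨c, lt_of_le_of_ne hc1.1 (by rintro rfl; linarith), hcb, hz, fun t ht => ?_⟩
  by_contra hn
  push Not at hn
  have : t ≤ c := hc3 ⟨⟨hc1.1.trans ht.1.le, ht.2⟩, hn⟩
  linarith [ht.1]

lemma first_zero {F : ℝ → ℝ} {a b : ℝ} (hab : a < b) (hF : ContinuousOn F (Set.Icc a b))
    (ha : F a < 0) (hb : 0 ≤ F b) :
    ∃ c, a < c ∧ c ≤ b ∧ F c = 0 ∧ ∀ t ∈ Set.Icc a c, F t ≤ 0 := by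
  have hcl : IsClosed (Set.Icc a b ∩ F ⁻¹' Set.Ici 0) :=
    hF.preimage_isClosed_of_isClosed isClosed_Icc isClosed_Ici
  have hco : IsCompact (Set.Icc a b ∩ F ⁻¹' Set.Ici 0) :=
    isCompact_Icc.of_isClosed_subset hcl Set.inter_subset_left
  obtain ⟨c, ⟨hc1, hc2⟩, hc3⟩ := hco.exists_isLeast ⟨b, ⟨hab.le, le_rfl⟩, hb⟩
  have hc2' : 0 ≤ F c := hc2
  have hz : F c = 0 := by
    obtain ⟨d, hd, hd0⟩ := intermediate_value_Icc hc1.1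
      (hF.mono (Set.Icc_subset_Icc_right hc1.2)) (show (0:ℝ) ∈ Set.Icc (F a) (F c) from ⟨ha.le, hc2'⟩)
    have : c ≤ d := hc3 ⟨⟨hd.1, hd.2.trans hc1.2⟩, hd0.ge⟩
    rw [← le_antisymm hd.2 this]; exact hd0
  refine ⟨c, lt_of_le_of_ne hc1.1 (by rintro rfl; linarith), hc1.2, hz, fun t ht => ?_⟩
  by_contra hn
  push Not at hn
  have : c ≤ t := hc3 ⟨⟨ht.1, ht.2.trans hc1.2⟩, hn.le⟩
  rw [← le_antisymm this ht.2, hz] at hn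
  exact lt_irrefl _ hn

/-- cap lemma -/
lemma cap_step (γ N j q r p s r' : ℝ) (h0 : 0 < γ) (hγ : γ < 1) (hN : 0 ≤ N) (hj : 0 ≤ j)
    (hq : 0 < q) (hr : 0 < r) (hp : 0 < p) (hs : 0 < s) (hle : r^2 ≤ p*q)
    (ri : (2*N+j+1)*(r^2 - p*q)*(s+p) + (j+1)*(r^2 - s*p)*(p+q) = 0)
    (sq : r'*(p*(2*N+2-γ) + s*(2*(N+j+1)+2-γ)) = r*(p*(2*(N+j+1)+γ)+s*(2*N+γ)))
    (hrr : r < r') : s < r := by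
  have hA : 0 < 2*N+2-γ := by linarith
  have hM : 0 < 2*(N+j+1)+2-γ := by linarith
  have h1 : r*(p*(2*N+2-γ) + s*(2*(N+j+1)+2-γ)) < r*(p*(2*(N+j+1)+γ)+s*(2*N+γ)) := by
    rw [← sq]; exact mul_lt_mul_of_pos_right hrr (by positivity)
  have h2 := lt_of_mul_lt_mul_left h1 hr.le
  have h3 : s*(2*j+4-2*γ) < p*(2*j+2*γ) := by linarith
  have h4 : s < p := by
    by_contra hc
    push Not at hc
    nlinarith
  have h5 : 0 ≤ (2*N+j+1)*(p*q - r^2)*(s+p) :=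
    mul_nonneg (mul_nonneg (by linarith) (by linarith)) (by linarith)
  have h6 : s*p ≤ r^2 := by
    by_contra hc
    push Not at hc
    have : 0 < (j+1)*(s*p-r^2)*(p+q) := mul_pos (mul_pos (by linarith) (by linarith)) (by linarith)
    linarith
  nlinarith

/-- one step: new `s` -/
def stS (N j q r p : ℝ) : ℝ :=
  ((2*N+j+1)*(r^2-p*q)*p + (j+1)*r^2*(p+q)) / ((2*N+j+1)*(p*q-r^2) + (j+1)*p*(p+q))

/-- one step: new `r'` -/
def stR (γ N j r p s : ℝ) : ℝ :=
  r*(p*(2*(N+j+1)+γ)+s*(2*N+γ)) / (p*(2*N+2-γ) + s*(2*(N+j+1)+2-γ))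

lemma den_pos (N j q r p : ℝ) (hN : 0 ≤ N) (hj : 0 ≤ j) (hq : 0 < q) (hp : 0 < p) (hle : r^2 ≤ p*q) :
    0 < (2*N+j+1)*(p*q-r^2) + (j+1)*p*(p+q) := by
  have : 0 ≤ p*q-r^2 := by linarith
  positivity

lemma stS_ri (N j q r p : ℝ) (hN : 0 ≤ N) (hj : 0 ≤ j) (hq : 0 < q) (hp : 0 < p) (hle : r^2 ≤ p*q) :
    (2*N+j+1)*(r^2 - p*q)*(stS N j q r p+p) + (j+1)*(r^2 - stS N j q r p*p)*(p+q) = 0 := by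
  have hd := den_pos N j q r p hN hj hq hp hle
  have : stS N j q r p * ((2*N+j+1)*(p*q-r^2) + (j+1)*p*(p+q)) = ((2*N+j+1)*(r^2-p*q)*p + (j+1)*r^2*(p+q)) := by
    rw [stS, div_mul_cancel₀ _ hd.ne']
  linear_combination -this

lemma den2_pos (γ N j p s : ℝ) (hγ : γ < 1) (hN : 0 ≤ N) (hj : 0 ≤ j) (hp : 0 < p) (hs : 0 ≤ s) :
    0 < p*(2*N+2-γ) + s*(2*(N+j+1)+2-γ) := by
  have hA : 0 < 2*N+2-γ := by linarith
  have hM : 0 < 2*(N+j+1)+2-γ := by linarith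
  positivity

lemma stR_sq (γ N j r p s : ℝ) (hγ : γ < 1) (hN : 0 ≤ N) (hj : 0 ≤ j) (hp : 0 < p) (hs : 0 ≤ s) :
    stR γ N j r p s *(p*(2*N+2-γ) + s*(2*(N+j+1)+2-γ)) = r*(p*(2*(N+j+1)+γ)+s*(2*N+γ)) := by
  rw [stR, div_mul_cancel₀ _ (den2_pos γ N j p s hγ hN hj hp hs).ne']

lemma stR_pos (γ N j r p s : ℝ) (h0 : 0 < γ) (hγ : γ < 1) (hN : 0 ≤ N) (hj : 0 ≤ j) (hp : 0 < p) (hs : 0 ≤ s)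
    (hr : 0 < r) : 0 < stR γ N j r p s := by
  have := den2_pos γ N j p s hγ hN hj hp hs
  rw [stR]
  positivity

structure ShInv (q r p : ℝ → ℝ) (l h : ℝ) : Prop where
  lt : l < h
  cq : ContinuousOn q (Set.Icc l h)
  cr : ContinuousOn r (Set.Icc l h)
  cp : ContinuousOn p (Set.Icc l h)
  qpos : ∀ t ∈ Set.Icc l h, 0 < q t
  ppos : ∀ t ∈ Set.Icc l h, 0 < p t
  rle : ∀ t ∈ Set.Icc l h, r t ^ 2 ≤ p t * q t
  rl : r l = 0
  rpos : ∀ t ∈ Set.Ioc l h, 0 < r t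
  rh : r h ^ 2 = p h * q h
  ph : p h ≤ q h

lemma ShInv.step {γ N j : ℝ} (h0 : 0 < γ) (hγ : γ < 1) (hN : 0 ≤ N) (hj : 0 ≤ j)
    {q r p : ℝ → ℝ} {l h : ℝ} (I : ShInv q r p l h) :
    ∃ l' h', l < l' ∧ h' ≤ h ∧ ShInv r (fun t => stS N j (q t) (r t) (p t))
      (fun t => stR γ N j (r t) (p t) (stS N j (q t) (r t) (p t))) l' h' := by
  set s : ℝ → ℝ := fun t => stS N j (q t) (r t) (p t) with hs
  set r' : ℝ → ℝ := fun t => stR γ N j (r t) (p t) (s t) with hr'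
  have ml : l ∈ Set.Icc l h := ⟨le_rfl, I.lt.le⟩
  have mh : h ∈ Set.Icc l h := ⟨I.lt.le, le_rfl⟩
  have cs : ContinuousOn s (Set.Icc l h) := by
    have c1 := I.cq
    have c2 := I.cr
    have c3 := I.cp
    simp only [hs, stS]
    refine ContinuousOn.div (by fun_prop) (by fun_prop) (fun t ht => ?_)
    exact (den_pos N j _ _ _ hN hj (I.qpos t ht) (I.ppos t ht) (I.rle t ht)).ne'
  have sl : s l < 0 := by
    have d := den_pos N j _ _ _ hN hj (I.qpos l ml) (I.ppos l ml) (I.rle l ml)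
    have a := I.qpos l ml
    have b := I.ppos l ml
    simp only [hs, stS]
    rw [I.rl] at d ⊢
    apply div_neg_of_neg_of_pos _ d
    have : 0 < (2*N+j+1)*(p l * q l)*p l := by positivity
    linarith
  have sh : s h = q h := by
    have d := den_pos N j _ _ _ hN hj (I.qpos h mh) (I.ppos h mh) (I.rle h mh)
    simp only [hs, stS]
    rw [div_eq_iff d.ne', I.rh]
    ring
  obtain ⟨l', h1, h2, h3, h4⟩ := last_zero I.lt cs sl (by rw [sh]; exact I.qpos h mh)
  have sub : Set.Icc l' h ⊆ Set.Icc l h := Set.Icc_subset_Icc_left h1.le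
  have snn : ∀ t ∈ Set.Icc l' h, 0 ≤ s t := by
    intro t ht
    rcases eq_or_lt_of_le ht.1 with e | e
    · rw [← e, h3]
    · exact (h4 t ⟨e, ht.2⟩).le
  have rp : ∀ t ∈ Set.Icc l' h, 0 < r t := fun t ht => I.rpos t ⟨h1.trans_le ht.1, ht.2⟩
  have r'p : ∀ t ∈ Set.Icc l' h, 0 < r' t := fun t ht =>
    stR_pos γ N j _ _ _ h0 hγ hN hj (I.ppos t (sub ht)) (snn t ht) (rp t ht)
  have cs' := cs.mono sub
  have cr' : ContinuousOn r' (Set.Icc l' h) := by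
    have c2 := I.cr.mono sub
    have c3 := I.cp.mono sub
    simp only [hr', stR]
    refine ContinuousOn.div (by fun_prop) (by fun_prop) (fun t ht => ?_)
    exact (den2_pos γ N j _ _ hγ hN hj (I.ppos t (sub ht)) (snn t ht)).ne'
  have ml' : l' ∈ Set.Icc l' h := ⟨le_rfl, h2.le⟩
  have mh' : h ∈ Set.Icc l' h := ⟨h2.le, le_rfl⟩
  have Gl : s l' ^ 2 - r' l' * r l' < 0 := by
    have := mul_pos (r'p l' ml') (rp l' ml')
    rw [h3]; linarith
  have Gh : 0 ≤ s h ^ 2 - r' h * r h := by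
    have a := I.qpos h mh
    have b := I.ppos h mh
    have d := den2_pos γ N j _ _ hγ hN hj (I.ppos h mh) (snn h mh')
    have e := stR_sq γ N j (r h) _ _ hγ hN hj (I.ppos h mh) (snn h mh')
    change r' h * _ = _ at e
    rw [sh] at d e ⊢
    have e2 : r' h * r h * (p h * (2 * N + 2 - γ) + q h * (2 * (N + j + 1) + 2 - γ)) =
       p h * q h * (p h * (2 * (N + j + 1) + γ) + q h * (2 * N + γ)) := by
      rw [← I.rh]; linear_combination r h * e
    have e3 : (q h ^ 2 - r' h * r h) * (p h * (2 * N + 2 - γ) + q h * (2 * (N + j + 1) + 2 - γ)) =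
      q h * ((p h + q h) * ((q h - p h) * (2 * (N + j + 1) + γ) + q h * (2 - 2*γ))) := by
      linear_combination -e2
    have e4 : 0 ≤ (q h ^ 2 - r' h * r h) * (p h * (2 * N + 2 - γ) + q h * (2 * (N + j + 1) + 2 - γ)) := by
      rw [e3]
      have : 0 ≤ q h - p h := by linarith [I.ph]
      have : 0 ≤ 2 - 2*γ := by linarith
      positivity
    exact nonneg_of_mul_nonneg_left e4 d
  have c2 := I.cr.mono sub
  obtain ⟨h', k1, k2, k3, k4⟩ := first_zero (F := fun t => s t ^ 2 - r' t * r t) h2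
    (by fun_prop) Gl Gh
  have sub2 : Set.Icc l' h' ⊆ Set.Icc l' h := Set.Icc_subset_Icc_right k2
  refine ⟨l', h', h1, k2, ⟨k1, c2.mono sub2, cs'.mono sub2, cr'.mono sub2, fun t ht => rp t (sub2 ht),
    fun t ht => r'p t (sub2 ht), fun t ht => ?_, h3, fun t ht => h4 t ⟨ht.1, ht.2.trans k2⟩, ?_, ?_⟩⟩
  · have := k4 t ht
    linarith
  · linarith
  · by_contra hc
    push Not at hc
    have mm : h' ∈ Set.Icc l' h := ⟨k1.le, k2⟩
    have s0 := h4 h' ⟨k1, k2⟩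
    have r0 := rp h' mm
    have := cap_step γ N j (q h') (r h') (p h') (s h') (r' h') h0 hγ hN hj (I.qpos h' (sub mm)) r0
      (I.ppos h' (sub mm)) s0 (I.rle h' (sub mm))
      (stS_ri N j _ _ _ hN hj (I.qpos h' (sub mm)) (I.ppos h' (sub mm)) (I.rle h' (sub mm)))
      (stR_sq γ N j _ _ _ hγ hN hj (I.ppos h' (sub mm)) s0.le) hc
    nlinarith

/-- orbit of the column recursion -/
def orb (γ : ℝ) (N : ℕ) (t : ℝ) : ℕ → ℝ × ℝ × ℝ
  | 0 => (1, t, cc γ N)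
  | j+1 =>
    let u := orb γ N t j
    (u.2.1, stS N j u.1 u.2.1 u.2.2, stR γ N j u.2.1 u.2.2 (stS N j u.1 u.2.1 u.2.2))

lemma cc_le_one {γ : ℝ} (h0 : 0 < γ) (hγ : γ < 1) (N : ℕ) : cc γ N ≤ 1 := by
  have hN : (0:ℝ) ≤ N := Nat.cast_nonneg N
  rw [cc, div_le_one (by linarith)]
  linarith

lemma shoot {γ : ℝ} (h0 : 0 < γ) (hγ : γ < 1) (N : ℕ) :
    ∃ f g : ℕ → ℝ, Col γ N f g ∧ f 0 = 1 ∧ ∀ j, f (j+1)^2 ≤ g j * f j := by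
  have hN : (0:ℝ) ≤ N := Nat.cast_nonneg N
  let I (j : ℕ) (u : ℝ × ℝ) : Prop := ShInv (fun t => (orb γ N t j).1) (fun t => (orb γ N t j).2.1)
    (fun t => (orb γ N t j).2.2) u.1 u.2
  have hc := cc_pos h0 hγ N
  have base : I 0 (0, Real.sqrt (cc γ N)) := by
    refine ⟨Real.sqrt_pos.2 hc, ?_, ?_, ?_, ?_, ?_, ?_, rfl, ?_, ?_, ?_⟩ <;> simp only [orb]
    · fun_prop
    · fun_prop
    · fun_prop
    · intros; exact one_pos
    · intros; exact hc
    · intro t ht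
      rw [mul_one]
      have := pow_le_pow_left₀ ht.1 ht.2 2
      rwa [Real.sq_sqrt hc.le] at this
    · intro t ht; exact ht.1
    · rw [Real.sq_sqrt hc.le, mul_one]
    · exact cc_le_one h0 hγ N
  have step : ∀ (j : ℕ) (u : ℝ × ℝ), I j u → ∃ u', I (j+1) u' ∧ u.1 < u'.1 ∧ u'.2 ≤ u.2 := by
    intro j u hu
    obtain ⟨l', h', a, b, c⟩ := ShInv.step h0 hγ hN (Nat.cast_nonneg j) hu
    exact ⟨(l', h'), c, a, b⟩
  choose! nx hnx using step
  let S : ℕ → ℝ × ℝ := fun n => Nat.rec (0, Real.sqrt (cc γ N)) (fun j u => nx j u) n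
  have hS : ∀ j, I j (S j) := by
    intro j
    induction j with
    | zero => exact base
    | succ j ih => exact (hnx j (S j) ih).1
  have hL : ∀ j, (S j).1 < (S (j+1)).1 := fun j => (hnx j (S j) (hS j)).2.1
  have hH : ∀ j, (S (j+1)).2 ≤ (S j).2 := fun j => (hnx j (S j) (hS j)).2.2
  have hmem := Monotone.ciSup_mem_iInter_Icc_of_antitone (f := fun j => (S j).1) (g := fun j => (S j).2)
    (monotone_nat_of_le_succ (fun j => (hL j).le)) (antitone_nat_of_succ_le hH) (fun j => (hS j).lt.le)
  set t := ⨆ j, (S j).1 with ht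
  rw [Set.mem_iInter] at hmem
  have rpos : ∀ j, 0 < (orb γ N t j).2.1 := fun j =>
    (hS j).rpos t ⟨(hL j).trans_le (hmem (j+1)).1, (hmem j).2⟩
  have qpos : ∀ j, 0 < (orb γ N t j).1 := fun j => (hS j).qpos t (hmem j)
  have ppos : ∀ j, 0 < (orb γ N t j).2.2 := fun j => (hS j).ppos t (hmem j)
  have rle : ∀ j, (orb γ N t j).2.1 ^ 2 ≤ (orb γ N t j).2.2 * (orb γ N t j).1 := fun j => (hS j).rle t (hmem j)
  refine ⟨fun j => (orb γ N t j).1, fun j => (orb γ N t j).2.2, ⟨qpos, ppos, ?_, ?_, ?_⟩, rfl, rle⟩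
  · simp only [orb, cc, mul_one]
  · intro j
    exact stS_ri N j _ _ _ hN (Nat.cast_nonneg j) (qpos j) (ppos j) (rle j)
  · intro j
    exact stR_sq γ N j _ _ _ hγ hN (Nat.cast_nonneg j) (ppos j) (rpos (j+1)).le


/-- the radii system on the right half, in natural coordinates -/
structure Sys (γ : ℝ) (U : ℕ → ℕ → ℝ) : Prop where
  u0 : U 0 0 = 1
  diag : ∀ n, U (n+1) 0 = cc γ n * U n 0
  ri : ∀ n j : ℕ, (2*(n:ℝ)+j+1)*(U n (j+1)^2 - U (n+1) j * U n j)*(U n (j+2)+U (n+1) j)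
    + ((j:ℝ)+1)*(U n (j+1)^2 - U n (j+2)*U (n+1) j)*(U (n+1) j + U n j) = 0
  sq : ∀ n j : ℕ, U (n+1) (j+1)*(U (n+1) j*(2*(n:ℝ)+2-γ) + U n (j+2)*(2*((n:ℝ)+j+1)+2-γ))
    = U n (j+1)*(U (n+1) j*(2*((n:ℝ)+j+1)+γ)+U n (j+2)*(2*(n:ℝ)+γ))

lemma Sys.dpos {γ : ℝ} (h0 : 0 < γ) (hγ : γ < 1) {U : ℕ → ℕ → ℝ} (h : Sys γ U) (n : ℕ) : 0 < U n 0 := by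
  induction n with
  | zero => rw [h.u0]; exact one_pos
  | succ n ih => rw [h.diag]; exact mul_pos (cc_pos h0 hγ n) ih

lemma Sys.l1 {γ : ℝ} (h0 : 0 < γ) (hγ : γ < 1) {U : ℕ → ℕ → ℝ} (h : Sys γ U) (n : ℕ)
    (hn : 0 < U n 1) : U n 1 * U (n+1) 1 = U (n+1) 0 ^ 2 := by
  have h1 := h.ri n 0
  have h2 := h.sq n 0
  simp only [Nat.cast_zero, zero_add] at h1 h2
  refine layer1 γ n (U n 0) (U n 1) (U n 2) (U (n+1) 0) (U (n+1) 1) h0 hγ (Nat.cast_nonneg n) (h.dpos h0 hγ n)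
    hn.ne' (h.diag n) ?_ ?_
  · linear_combination h1
  · linear_combination h2

lemma Sys.pos1 {γ : ℝ} (h0 : 0 < γ) (hγ : γ < 1) {U : ℕ → ℕ → ℝ} (h : Sys γ U) (hs : 0 < U 0 1) (n : ℕ) :
    0 < U n 1 := by
  induction n with
  | zero => exact hs
  | succ n ih =>
    have := h.l1 h0 hγ n ih
    have h3 : 0 < U n 1 * U (n+1) 1 := by
      rw [this]; exact pow_pos (h.dpos h0 hγ _) 2
    exact pos_of_mul_pos_right h3 ih.le

lemma Sys.recur {γ : ℝ} (h0 : 0 < γ) (hγ : γ < 1) {U : ℕ → ℕ → ℝ} (h : Sys γ U) (hs : 0 < U 0 1) (n : ℕ) :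
    (U n 1 / U n 0) * (U (n+1) 1 / U (n+1) 0) = cc γ n := by
  have h1 := h.l1 h0 hγ n (h.pos1 h0 hγ hs n)
  have a := h.dpos h0 hγ n
  have b := h.dpos h0 hγ (n+1)
  rw [div_mul_div_comm, h1, div_eq_iff (by positivity), pow_two]
  nth_rewrite 1 [h.diag n]
  ring

lemma Col.scale {γ : ℝ} {N : ℕ} {f g : ℕ → ℝ} (h : Col γ N f g) {d : ℝ} (hd : 0 < d) :
    Col γ N (fun j => d * f j) (fun j => d * g j) := by
  refine ⟨fun j => mul_pos hd (h.fpos j), fun j => mul_pos hd (h.gpos j), ?_, fun j => ?_, fun j => ?_⟩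
  · linear_combination d * h.g0
  · linear_combination d^3 * h.ri j
  · linear_combination d^2 * h.sq j

lemma Sys.col {γ : ℝ} (h0 : 0 < γ) (hγ : γ < 1) {U : ℕ → ℕ → ℝ} (h : Sys γ U)
    (hs : U 0 1 = 1 * Real.tan (γ * Real.pi / 4)) (n : ℕ) :
    Col γ n (U n) (U (n+1)) ∧ ∀ j, U n (j+1)^2 ≤ U (n+1) j * U n j := by
  have hs0 : 0 < U 0 1 := by
    rw [hs, one_mul]
    have := Real.pi_pos
    exact Real.tan_pos_of_pos_of_lt_pi_div_two (by positivity) (by nlinarith)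
  have hn : (0:ℝ) ≤ n := Nat.cast_nonneg n
  obtain ⟨f, g, hc, hf0, hle⟩ := shoot h0 hγ n
  have hd := h.dpos h0 hγ n
  have hlim := rho_lim h0 hγ (fun n => U n 1 / U n 0)
    (fun n => div_pos (h.pos1 h0 hγ hs0 n) (h.dpos h0 hγ n)) (h.recur h0 hγ hs0) (by
      simp only [h.u0, div_one]; exact hs)
  have heq := hc.eq h0 hγ (fun n => U n 1 / U n 0)
    (fun n => div_pos (h.pos1 h0 hγ hs0 n) (h.dpos h0 hγ n)) (h.recur h0 hγ hs0) hlim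
  simp only [hf0, div_one] at heq
  have cs := hc.scale hd
  have hle' : ∀ j, (U n 0 * f (j+1))^2 ≤ (U n 0 * g j) * (U n 0 * f j) := by
    intro j
    have := mul_le_mul_of_nonneg_left (hle j) (pow_pos hd 2).le
    linarith
  have key : ∀ j, U n j = U n 0 * f j ∧ U n (j+1) = U n 0 * f (j+1) ∧ U (n+1) j = U n 0 * g j := by
    intro j
    induction j with
    | zero =>
      refine ⟨by rw [hf0, mul_one], ?_, ?_⟩
      · rw [heq]; field_simp
      · rw [h.diag, cs.g0, hf0, mul_one, cc]
    | succ j ih =>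
      obtain ⟨i1, i2, i3⟩ := ih
      have hj : (0:ℝ) ≤ j := Nat.cast_nonneg j
      have e1 := h.ri n j
      have e2 := h.sq n j
      rw [i1, i2, i3] at e1
      rw [i2, i3] at e2
      have c1 := cs.ri j
      have c2 := cs.sq j
      have q0 := cs.fpos j
      have r0 := cs.fpos (j+1)
      have s0 := cs.fpos (j+2)
      have p0 := cs.gpos j
      have l0 := hle' j

      have es : U n (j+2) = U n 0 * f (j+2) := by
        have dp := den_pos n j _ _ _ hn hj q0 p0 l0
        apply mul_right_cancel₀ dp.ne'
        linear_combination c1 - e1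
      rw [es] at e2
      refine ⟨i2, es, ?_⟩
      have dp := den2_pos γ n j _ _ hγ hn hj p0 s0.le
      apply mul_right_cancel₀ dp.ne'
      linear_combination e2 - c2
  have k1 : U n = fun j => U n 0 * f j := funext fun j => (key j).1
  have k2 : U (n+1) = fun j => U n 0 * g j := funext fun j => (key j).2.2
  constructor
  · rw [k2]; nth_rewrite 1 [k1]; exact cs
  · intro j
    rw [(key j).1, (key j).2.1, (key j).2.2]
    exact hle' j

lemma Sys.le_one {γ : ℝ} (h0 : 0 < γ) (hγ : γ < 1) {U : ℕ → ℕ → ℝ} (h : Sys γ U) (n : ℕ)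
    (hc : Col γ n (U n) (U (n+1))) (hle : ∀ j, U n (j+1)^2 ≤ U (n+1) j * U n j) (j : ℕ) :
    U n (j+1) ≤ U n j := by
  by_cases hp : U (n+1) j ≤ U n j
  · have := hle j
    have a := hc.fpos j
    have b := hc.fpos (j+1)
    by_contra hcon
    push Not at hcon
    nlinarith
  · push Not at hp
    cases j with
    | zero =>
      rw [h.diag] at hp
      have := cc_le_one h0 hγ n
      have a := hc.fpos 0
      nlinarith
    | succ j =>
      exact (cap_step γ n j (U n j) (U n (j+1)) (U (n+1) j) (U n (j+2)) (U (n+1) (j+1)) h0 hγ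
        (Nat.cast_nonneg n) (Nat.cast_nonneg j) (hc.fpos j) (hc.fpos _) (hc.gpos _) (hc.fpos _) (hle j)
        (hc.ri j) (hc.sq j) hp).le


lemma sys_of (γ : ℝ) (R : ℤ → ℤ → ℝ) (hsol : IsRadiiSolution γ R) (h0 : R 0 0 = 1) :
    Sys γ (fun n j : ℕ => R (n:ℤ) ((n:ℤ)+(j:ℤ))) := by
  obtain ⟨hsq, hd, hri⟩ := hsol
  refine ⟨by simpa using h0, fun n => ?_, fun n j => ?_, fun n j => ?_⟩
  · have := (hd n).1
    simp only [cc]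
    push_cast
    simpa using this
  · have h := hri (n:ℤ) ((n:ℤ)+j+1) (by unfold inVint; rw [abs_of_nonneg (by positivity)]; omega)
    unfold RiEq at h
    push_cast at h ⊢
    rw [show (n:ℤ)+j+1-1 = n+j by ring, show (n:ℤ)+j+1+1 = n+(j+2) by ring,
      show (n:ℤ)+j+1 = n+(j+1) by ring] at h
    rw [show (n:ℤ)+1+j = n+(j+1) by ring]
    linear_combination h
  · have a1 : |(n:ℤ)| = n := abs_of_nonneg (by positivity)
    have a2 : |(n:ℤ)+1| = n+1 := abs_of_nonneg (by positivity)
    have h := hsq (n:ℤ) ((n:ℤ)+j+1) (by unfold inV; rw [a1]; omega) (by unfold inV; rw [a2]; omega)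
      (by unfold inV; rw [a1]; omega) (by unfold inV; rw [a2]; omega)
    unfold SquareEq at h
    push_cast at h ⊢
    rw [show (n:ℤ)+j+1+1 = n+(j+2) by ring,
      show (n:ℤ)+j+1 = n+(j+1) by ring] at h
    rw [show (n:ℤ)+1+j = n+(j+1) by ring, show (n:ℤ)+1+(j+1) = n+(j+2) by ring]
    linear_combination h

/-- for `0 < γ < 1`, the quantities `P(N,M)`, `Q(N,M)` stay in the
region `D₀ = {P > 0, 0 ≤ Q ≤ F(P)}` for all `M > N ≥ 0` iff `a = 1`. -/
theorem stmt16 (γ : ℝ) (hγ0 : 0 < γ) (hγ1 : γ < 1) (a : ℝ) (ha : 0 < a)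
    (R : ℤ → ℤ → ℝ) (hsol : IsRadiiSolution γ R)
    (h0 : R 0 0 = 1) (hi : R 0 1 = a * Real.tan (γ * Real.pi / 4))
    (P Q : ℤ → ℤ → ℝ)
    (hP : ∀ N M : ℤ, P N M = R (N + 1) M / R N (M - 1))
    (hQ : ∀ N M : ℤ, Q N M = R N M / R N (M - 1)) :
    (∀ N M : ℤ, 0 ≤ N → N < M →
        0 < P N M ∧ 0 ≤ Q N M ∧ Q N M ≤ Fcap (P N M)) ↔ a = 1 := by
  have hS := sys_of γ R hsol h0
  set U : ℕ → ℕ → ℝ := fun n j : ℕ => R (n:ℤ) ((n:ℤ)+(j:ℤ)) with hU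
  have hU1 : U 0 1 = a * Real.tan (γ * Real.pi / 4) := by
    rw [hU]; simpa using hi
  have ht : 0 < Real.tan (γ * Real.pi / 4) := by
    have := Real.pi_pos
    exact Real.tan_pos_of_pos_of_lt_pi_div_two (by positivity) (by nlinarith)
  have hs0 : 0 < U 0 1 := by rw [hU1]; exact mul_pos ha ht
  have hQ' : ∀ n j : ℕ, Q n ((n:ℤ)+j+1) = U n (j+1) / U n j := by
    intro n j
    rw [hQ, hU]
    push_cast
    rw [show (n:ℤ)+j+1-1 = n+j by ring, show (n:ℤ)+j+1 = n+(j+1) by ring]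
  have hP' : ∀ n j : ℕ, P n ((n:ℤ)+j+1) = U (n+1) j / U n j := by
    intro n j
    rw [hP, hU]
    push_cast
    rw [show (n:ℤ)+j+1-1 = n+j by ring, show (n:ℤ)+j+1 = n+1+j by ring]
  constructor
  · intro h
    refine rho_eq_one hγ0 hγ1 a ha (fun n => U n 1 / U n 0)
      (fun n => div_pos (hS.pos1 hγ0 hγ1 hs0 n) (hS.dpos hγ0 hγ1 n)) (hS.recur hγ0 hγ1 hs0)
      (by simp only [hS.u0, div_one]; exact hU1) (fun n => ?_)
    have h1 := (h n ((n:ℤ)+(0:ℕ)+1) (by positivity) (by push_cast; omega)).2.2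
    rw [hQ'] at h1
    refine h1.trans ?_
    unfold Fcap
    split_ifs with hc
    · exact Real.sqrt_le_one.2 hc
    · exact le_rfl
  · intro h1 N M hN hM
    rw [h1] at hU1
    obtain ⟨n, rfl⟩ := Int.eq_ofNat_of_zero_le hN
    obtain ⟨j, hj⟩ := Int.eq_ofNat_of_zero_le (show 0 ≤ M - n - 1 by omega)
    obtain rfl : M = (n:ℤ)+j+1 := by omega
    obtain ⟨hc, hle⟩ := hS.col hγ0 hγ1 hU1 n
    rw [hP', hQ']
    have p1 : 0 < U (n+1) j / U n j := div_pos (hc.gpos j) (hc.fpos j)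
    have p2 : 0 < U n (j+1) / U n j := div_pos (hc.fpos (j+1)) (hc.fpos j)
    refine ⟨p1, p2.le, ?_⟩
    have f0 := hc.fpos j
    unfold Fcap
    split_ifs with hcond
    · apply Real.le_sqrt_of_sq_le
      rw [div_pow, div_le_div_iff₀ (by positivity) f0]
      have := mul_le_mul_of_nonneg_right (hle j) f0.le
      linarith
    · rw [div_le_one f0]
      exact hS.le_one hγ0 hγ1 n hc hle j
end
end

section
/- Let 0 < γ < 2 and let R: V → ℝ be a solution of the radii system with R(z) > 0 on V. For z = N+iM ∈ V_int define P(N,M) = R(z+1)/R(z−i) and Q(N,M) = R(z)/R(z−i). Then whenever both z = N+iM and z+i lie in V_int, the following discrete-Painlevé-type relations hold (in cross-multiplied form): Q(N,M+1)·Q(N,M)·[(M+N)(Q(N,M)²−P(N,M)) − (M−N)P(N,M)(1+P(N,M))] = (M+N)P(N,M)(P(N,M)−Q(N,M)²) − (M−N)Q(N,M)²(1+P(N,M)), and P(N,M+1)·[(2(N+1)−γ)P(N,M) + (2(M+1)−γ)Q(N,M)Q(N,M+1)] = (2M+γ)P(N,M) + (2N+γ)Q(N,M)Q(N,M+1). 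-/
open Real
/-- the quantities `P`, `Q` built from a positive solution of the radii
system satisfy the discrete-Painlevé-type relations (in cross-multiplied form). -/
theorem stmt17 (γ : ℝ) (hγ0 : 0 < γ) (hγ2 : γ < 2)
    (R : ℤ → ℤ → ℝ) (hsol : IsRadiiSolution γ R)
    (hpos : ∀ N M : ℤ, inV N M → 0 < R N M)
    (P Q : ℤ → ℤ → ℝ)
    (hP : ∀ N M : ℤ, P N M = R (N + 1) M / R N (M - 1))
    (hQ : ∀ N M : ℤ, Q N M = R N M / R N (M - 1)) :
    ∀ N M : ℤ, inVint N M → inVint N (M + 1) →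
      Q N (M + 1) * Q N M *
          (((M : ℝ) + N) * (Q N M ^ 2 - P N M) - ((M : ℝ) - N) * P N M * (1 + P N M)) =
        ((M : ℝ) + N) * P N M * (P N M - Q N M ^ 2) -
          ((M : ℝ) - N) * Q N M ^ 2 * (1 + P N M) ∧
      P N (M + 1) *
          ((2 * ((N : ℝ) + 1) - γ) * P N M + (2 * ((M : ℝ) + 1) - γ) * Q N M * Q N (M + 1)) =
        (2 * (M : ℝ) + γ) * P N M + (2 * (N : ℝ) + γ) * Q N M * Q N (M + 1) := by 
  intro N M h1 h2
  obtain ⟨hsq, -, hri⟩ := hsol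
  unfold inVint at h1 h2
  have hb0 := abs_lt.mp h1
  have e1 := hri N M h1
  have e2 := hsq N M (by unfold inV; omega) (by unfold inV; rw [abs_le]; omega)
    (by unfold inV; omega) (by unfold inV; rw [abs_le]; omega)
  have ha : R N (M - 1) ≠ 0 := (hpos N (M - 1) (by unfold inV; omega)).ne'
  have hb : R N M ≠ 0 := (hpos N M (by unfold inV; omega)).ne'
  unfold RiEq at e1
  unfold SquareEq at e2
  simp only [hP, hQ, add_sub_cancel_right]
  generalize R N (M - 1) = a at *
  generalize R N M = b at *
  generalize R (N + 1) M = c at *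
  generalize R N (M + 1) = d at *
  generalize R (N + 1) (M + 1) = e at *
  constructor
  · field_simp
    linear_combination e1
  · field_simp
    linear_combination e2
end
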